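/- Let n ≥ 1, let σ be a permutation of Fin (2n) that is a single cycle of length 2n, and let ρ be a fixed-point-free involution of Fin (2n) such that ρ ∘ σ has exactly n + 1 orbits on Fin (2n). Fix m₀ ∈ Fin (2n), define ι : Fin (2n) → ℂ by ι(σ^k(m₀)) = exp(2πik/(2n)) for 0 ≤ k < 2n. Then the closed line segments in ℂ joining ι(m) and ι(ρ m), taken over the orbits {m, ρ m} of ρ, are pairwise disjoint. -/

import Mathlib

open scoped Real

/-- Number of orbits of the cyclic group generated by a permutation `π`
(fixed points are counted as orbits of size 1). -/
noncomputable def numOrbits {α : Type*} (p : Equiv.Perm α) : ℕ :=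
  Nat.card (MulAction.orbitRel.Quotient (Subgroup.zpowers p) α)

lemma finrank_inv {N : ℕ} (p : Equiv.Perm (Fin N)) (V : Submodule ℚ (Fin N → ℚ))
    (hV : ∀ f, f ∈ V ↔ ∀ x, f (p x) = f x) : numOrbits p ≤ Module.finrank ℚ V := by
  classical
  let Q := MulAction.orbitRel.Quotient (Subgroup.zpowers p) (Fin N)
  let mk : Fin N → Q := fun x => Quotient.mk _ x
  have hmk : Function.Surjective mk := Quotient.mk_surjective
  have : Finite Q := Finite.of_surjective mk hmk
  have : Fintype Q := Fintype.ofFinite Q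
  have hp : ∀ x, mk (p x) = mk x := by
    intro x
    apply Quotient.sound
    exact ⟨⟨p, Subgroup.mem_zpowers p⟩, rfl⟩
  let T : (Q → ℚ) →ₗ[ℚ] V := LinearMap.codRestrict V (LinearMap.funLeft ℚ ℚ mk) (by
    intro g
    rw [hV]
    intro x
    simp [LinearMap.funLeft_apply, hp])
  have hT : Function.Injective T := by
    intro g h hgh
    have : LinearMap.funLeft ℚ ℚ mk g = LinearMap.funLeft ℚ ℚ mk h := congrArg Subtype.val hgh
    exact LinearMap.funLeft_injective_of_surjective ℚ ℚ mk hmk this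
  have := LinearMap.finrank_le_finrank_of_injective hT
  rw [Module.finrank_fintype_fun_eq_card] at this
  unfold numOrbits
  rw [Nat.card_eq_fintype_card]
  convert this

lemma exists_potential (n : ℕ) (σ ρ : Equiv.Perm (Fin (2 * n)))
    (m₀ : Fin (2 * n)) (hcov : ∀ x, ∃ k, k < 2 * n ∧ (σ ^ k) m₀ = x)
    (hρ : ∀ x, ρ (ρ x) = x) (hρfix : ∀ m, ρ m ≠ m)
    (horb : numOrbits (ρ * σ) = n + 1) (h : Fin (2 * n) → ℚ) (hh : ∀ x, h (ρ x) = - h x) :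
    ∃ f : Fin (2 * n) → ℚ, (∀ x, f (ρ (σ x)) = f x) ∧ ∀ y, f y - f (ρ y) = h y := by
  classical
  let V : Submodule ℚ (Fin (2*n) → ℚ) :=
    { carrier := {f | ∀ x, f ((ρ * σ) x) = f x}
      add_mem' := by intro f g hf hg x; simp only [Set.mem_ofPred_eq, Pi.add_apply] at *; rw [hf, hg]
      zero_mem' := by intro x; rfl
      smul_mem' := by intro c f hf x; simp only [Set.mem_ofPred_eq, Pi.smul_apply] at *; rw [hf] }
  let A : Submodule ℚ (Fin (2*n) → ℚ) :=
    { carrier := {f | ∀ x, f (ρ x) = - f x}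
      add_mem' := by
        intro f g hf hg x; simp only [Set.mem_ofPred_eq, Pi.add_apply] at *; rw [hf, hg]; ring
      zero_mem' := by intro x; simp
      smul_mem' := by intro c f hf x; simp only [Set.mem_ofPred_eq, Pi.smul_apply] at *; rw [hf]; simp }
  have hVd : n + 1 ≤ Module.finrank ℚ V := horb ▸ finrank_inv (ρ * σ) V (fun f => Iff.rfl)
  have hAd : Module.finrank ℚ A ≤ n := by
    let ε : Fin (2*n) → ℚ := fun x => if x < ρ x then 1 else -1
    have hε : ∀ x, ε (ρ x) = - ε x := by
      intro x
      simp only [ε, hρ]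
      rcases lt_trichotomy x (ρ x) with h1 | h1 | h1
      · simp [h1, h1.not_gt]
      · exact absurd h1.symm (hρfix x)
      · simp [h1, h1.not_gt]
    have hε0 : ∀ x, ε x ≠ 0 := by
      intro x; simp only [ε]; split_ifs <;> norm_num
    let T : (A × A) →ₗ[ℚ] (Fin (2*n) → ℚ) :=
      { toFun := fun p x => p.1.1 x + ε x * p.2.1 x
        map_add' := by intro p q; ext x; simp; ring
        map_smul' := by intro c q; ext x; simp; ring }
    have hT : Function.Injective T := by
      rw [← LinearMap.ker_eq_bot, LinearMap.ker_eq_bot']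
      rintro ⟨g, k⟩ hgk
      have e : ∀ x, g.1 x + ε x * k.1 x = 0 := fun x => congrFun hgk x
      have e2 : ∀ x, g.1 x = 0 ∧ ε x * k.1 x = 0 := by
        intro x
        have h1 := e x
        have h2 := e (ρ x)
        rw [g.2 x, k.2 x, hε] at h2
        constructor <;> linarith
      ext x
      · exact (e2 x).1
      · exact (mul_eq_zero.1 (e2 x).2).resolve_left (hε0 x)
    have := LinearMap.finrank_le_finrank_of_injective hT
    rw [Module.finrank_prod, Module.finrank_fintype_fun_eq_card, Fintype.card_fin] at this
    omega
  let D : V →ₗ[ℚ] A :=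
    { toFun := fun f => ⟨fun x => f.1 x - f.1 (ρ x), by intro x; simp [hρ]⟩
      map_add' := by intro f g; ext x; simp; ring
      map_smul' := by intro c f; ext x; simp; ring }
  have hker : Module.finrank ℚ (LinearMap.ker D) ≤ 1 := by
    let E : LinearMap.ker D →ₗ[ℚ] ℚ :=
      { toFun := fun f => f.1.1 m₀
        map_add' := by intro f g; simp
        map_smul' := by intro c f; simp }
    have hE : Function.Injective E := by
      rintro ⟨⟨f, hf⟩, hfD⟩ ⟨⟨g, hg⟩, hgD⟩ hfE
      have h0 : f m₀ = g m₀ := hfE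
      have hD : ∀ x, f x - f (ρ x) = 0 := by
        intro x
        have := congrArg (fun g : A => g.1 x) (LinearMap.mem_ker.1 hfD)
        exact this
      have hD' : ∀ x, g x - g (ρ x) = 0 := by
        intro x
        have := congrArg (fun g : A => g.1 x) (LinearMap.mem_ker.1 hgD)
        exact this
      have hs : ∀ k : ℕ, f ((σ ^ k) m₀) = g ((σ ^ k) m₀) := by
        intro k
        induction k with
        | zero => simpa using h0
        | succ k ih =>
          rw [pow_succ', Equiv.Perm.mul_apply]
          have h1 := hD (σ ((σ ^ k) m₀))
          have h2 : f (ρ (σ ((σ ^ k) m₀))) = f ((σ ^ k) m₀) := hf _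
          have h3 := hD' (σ ((σ ^ k) m₀))
          have h4 : g (ρ (σ ((σ ^ k) m₀))) = g ((σ ^ k) m₀) := hg _
          linarith
      apply Subtype.ext
      apply Subtype.ext
      funext x
      obtain ⟨k, -, rfl⟩ := hcov x
      exact hs k
    have := LinearMap.finrank_le_finrank_of_injective hE
    simpa using this
  have hrn := LinearMap.finrank_range_add_finrank_ker D
  have hsurj : LinearMap.range D = ⊤ := by
    apply Submodule.eq_top_of_finrank_eq
    have := Submodule.finrank_le (LinearMap.range D)
    omega
  obtain ⟨f, hf⟩ := LinearMap.range_eq_top.1 hsurj ⟨h, hh⟩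
  refine ⟨f.1, f.2, fun y => ?_⟩
  exact congrArg (fun g : A => g.1 y) hf

lemma noncross (n : ℕ) (σ ρ : Equiv.Perm (Fin (2 * n)))
    (m₀ : Fin (2 * n)) (hcov : ∀ x, ∃ k, k < 2 * n ∧ (σ ^ k) m₀ = x)
    (hinj : ∀ k l, k < 2 * n → l < 2 * n → (σ ^ k) m₀ = (σ ^ l) m₀ → k = l)
    (hρ : ∀ x, ρ (ρ x) = x) (hρfix : ∀ m, ρ m ≠ m)
    (horb : numOrbits (ρ * σ) = n + 1) (i j k l : ℕ) (hi : i < 2 * n) (hj : j < 2 * n)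
    (hk : k < 2 * n) (hl : l < 2 * n) (hij : ρ ((σ ^ i) m₀) = (σ ^ j) m₀)
    (hkl : ρ ((σ ^ k) m₀) = (σ ^ l) m₀) (hki : k ≠ i) (hkj : k ≠ j) :
    ((k < i ↔ k < j) ↔ (l < i ↔ l < j)) ∧ l ≠ i ∧ l ≠ j := by
  have hli : l ≠ i := by
    rintro rfl
    apply hkj
    apply hinj _ _ hk hj
    rw [← hij, ← hkl, hρ]
  have hlj : l ≠ j := by
    rintro rfl
    apply hki
    apply hinj _ _ hk hi
    exact ρ.injective (hkl.trans hij.symm)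
  refine ⟨?_, hli, hlj⟩
  have hji : ρ ((σ ^ j) m₀) = (σ ^ i) m₀ := by rw [← hij, hρ]
  obtain ⟨f, hf, hfh⟩ := exists_potential n σ ρ m₀ hcov hρ hρfix horb
    (fun x => (if x = (σ ^ i) m₀ then 1 else 0) - (if x = (σ ^ j) m₀ then 1 else 0)) (by
      intro x
      have e1 : ρ x = (σ ^ i) m₀ ↔ x = (σ ^ j) m₀ := by
        rw [← hji]; exact ρ.injective.eq_iff
      have e2 : ρ x = (σ ^ j) m₀ ↔ x = (σ ^ i) m₀ := by
        rw [← hij]; exact ρ.injective.eq_iff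
      simp only [e1, e2]
      ring)
  have key : ∀ t, t < 2 * n → ∀ u, u < 2 * n →
      ((σ ^ t) m₀ = (σ ^ u) m₀ ↔ t = u) := fun t ht u hu =>
    ⟨hinj t u ht hu, fun h => by rw [h]⟩
  have hF : ∀ t, t < 2 * n → f ((σ ^ t) m₀) - (if i ≤ t then 1 else 0) + (if j ≤ t then 1 else 0)
      = f m₀ - (if i ≤ 0 then 1 else 0) + (if j ≤ 0 then 1 else 0) := by
    intro t
    induction t with
    | zero => intro _; simp
    | succ t ih =>
      intro ht
      have ih := ih (by omega)
      have h1 := hfh ((σ ^ (t+1)) m₀)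
      have h2 := hf ((σ ^ t) m₀)
      rw [← Equiv.Perm.mul_apply σ, ← pow_succ'] at h2
      simp only [key _ ht _ hi, key _ ht _ hj] at h1
      rw [← ih]
      rw [h2] at h1
      have a1 : (if i ≤ t + 1 then (1:ℚ) else 0) = (if i ≤ t then 1 else 0) + if t + 1 = i then 1 else 0 := by
        split_ifs <;> first | omega | norm_num
      have a2 : (if j ≤ t + 1 then (1:ℚ) else 0) = (if j ≤ t then 1 else 0) + if t + 1 = j then 1 else 0 := by
        split_ifs <;> first | omega | norm_num
      rw [a1, a2]
      linarith
  have hb := hfh ((σ ^ k) m₀)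
  rw [hkl] at hb
  simp only [key _ hk _ hi, key _ hk _ hj, hki, hkj, if_false] at hb
  have h1 := hF k hk
  have h2 := hF l hl
  have h3 : (if i ≤ k then (1:ℚ) else 0) - (if j ≤ k then 1 else 0)
    = (if i ≤ l then (1:ℚ) else 0) - (if j ≤ l then 1 else 0) := by linarith
  split_ifs at h3 <;> first | omega | (norm_num at h3)

lemma sin_half_sign (n : ℕ) (hn : 1 ≤ n) (k i : ℕ) (hk : k < 2 * n) (hi : i < 2 * n) :
    (k < i → Real.sin (π * k / (2 * n) - π * i / (2 * n)) < 0) ∧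
    (i < k → 0 < Real.sin (π * k / (2 * n) - π * i / (2 * n))) := by
  have main : ∀ k i : ℕ, k < 2 * n → i < k →
      0 < Real.sin (π * k / (2 * n) - π * i / (2 * n)) := by
    intro k i hk h
    have hn' : (0:ℝ) < 2 * n := by positivity
    have e : π * k / (2 * n) - π * i / (2 * n) = π * ((k - i : ℝ) / (2 * n)) := by ring
    have h1 : (0:ℝ) < k - i := by
      have : (i:ℝ) < k := by exact_mod_cast h
      linarith
    have h2 : (k - i : ℝ) / (2 * n) < 1 := by
      rw [div_lt_one hn']
      have : (k:ℝ) < 2 * n := by exact_mod_cast hk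
      have : (0:ℝ) ≤ i := by positivity
      linarith
    rw [e]
    apply Real.sin_pos_of_pos_of_lt_pi
    · positivity
    · nlinarith [Real.pi_pos]
  refine ⟨fun h => ?_, main k i hk⟩
  have := main i k hi h
  rw [← neg_sub, Real.sin_neg]
  linarith

lemma functional (a b t : ℝ) :
    (Complex.exp ((2 * t : ℝ) * Complex.I)).re * Real.cos (a + b)
      + (Complex.exp ((2 * t : ℝ) * Complex.I)).im * Real.sin (a + b) - Real.cos (a - b)
      = - 2 * (Real.sin (t - a) * Real.sin (t - b)) := by
  rw [Complex.exp_ofReal_mul_I_re, Complex.exp_ofReal_mul_I_im]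
  have h1 : Real.cos (2*t) * Real.cos (a + b) + Real.sin (2*t) * Real.sin (a+b)
    = Real.cos ((t - a) + (t - b)) := by
    rw [← Real.cos_sub]; congr 1; ring
  have h2 : Real.cos (a - b) = Real.cos ((t - b) - (t - a)) := by congr 1; ring
  rw [h1, h2, Real.cos_add, Real.cos_sub (t - b) (t - a)]
  ring

theorem stmt8 (n : ℕ) (hn : 1 ≤ n) (σ ρ : Equiv.Perm (Fin (2 * n)))
    (hσ : σ.IsCycle) (hσlen : σ.support.card = 2 * n)
    (hρ2 : ρ * ρ = 1) (hρfix : ∀ m, ρ m ≠ m)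
    (horb : numOrbits (ρ * σ) = n + 1)
    (m₀ : Fin (2 * n)) (ι : Fin (2 * n) → ℂ)
    (hι : ∀ k : ℕ, k < 2 * n →
      ι ((σ ^ k) m₀) = Complex.exp (2 * π * Complex.I * k / (2 * n))) :
    ∀ a b : Fin (2 * n), ({a, ρ a} : Set (Fin (2 * n))) ≠ ({b, ρ b} : Set (Fin (2 * n))) →
      Disjoint (segment ℝ (ι a) (ι (ρ a))) (segment ℝ (ι b) (ι (ρ b))) := by
  have hρ : ∀ x, ρ (ρ x) = x := fun x => by
    rw [← Equiv.Perm.mul_apply, hρ2]; rfl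
  have hsupp : σ.support = Finset.univ := by
    apply Finset.eq_univ_of_card; rw [hσlen, Fintype.card_fin]
  have hcov : ∀ x, ∃ k, k < 2 * n ∧ (σ ^ k) m₀ = x := by
    intro x
    have h1 : σ.SameCycle m₀ x := hσ.sameCycle (by
      rw [← Equiv.Perm.mem_support, hsupp]; simp) (by
      rw [← Equiv.Perm.mem_support, hsupp]; simp)
    obtain ⟨k, hk, hk'⟩ := h1.exists_pow_eq'
    refine ⟨k, lt_of_lt_of_le hk ?_, hk'⟩
    rw [hσ.orderOf, hσlen]
  have hinj : ∀ k l, k < 2 * n → l < 2 * n → (σ ^ k) m₀ = (σ ^ l) m₀ → k = l := by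
    have hs : Function.Surjective (fun k : Fin (2 * n) => (σ ^ (k:ℕ)) m₀) := by
      intro x
      obtain ⟨k, hk, hx⟩ := hcov x
      exact ⟨⟨k, hk⟩, hx⟩
    have hi := Finite.injective_iff_surjective.2 hs
    intro k l hk hl h
    exact congrArg Fin.val (@hi ⟨k, hk⟩ ⟨l, hl⟩ h)
  intro a b hab
  obtain ⟨i, hi, ha⟩ := hcov a
  obtain ⟨j, hj, ha'⟩ := hcov (ρ a)
  obtain ⟨k, hk, hb⟩ := hcov b
  obtain ⟨l, hl, hb'⟩ := hcov (ρ b)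
  have hki : k ≠ i := by
    rintro rfl
    apply hab
    rw [← ha, ← hb]
  have hkj : k ≠ j := by
    rintro rfl
    apply hab
    have : b = ρ a := hb.symm.trans ha'
    rw [this, hρ, Set.pair_comm]
  obtain ⟨hc, hli, hlj⟩ := noncross n σ ρ m₀ hcov hinj hρ hρfix horb i j k l hi hj hk hl
    (by rw [ha, ha']) (by rw [hb, hb']) hki hkj
  have hι' : ∀ t : ℕ, t < 2 * n → ι ((σ ^ t) m₀) =
      Complex.exp ((2 * (π * t / (2 * n)) : ℝ) * Complex.I) := by
    intro t ht
    rw [hι t ht]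
    congr 1
    push_cast
    ring
  have hia := hι' i hi
  have hja := hι' j hj
  have hkb := hι' k hk
  have hlb := hι' l hl
  rw [ha] at hia
  rw [ha'] at hja
  rw [hb] at hkb
  rw [hb'] at hlb
  have fi := functional (π * i / (2 * n)) (π * j / (2 * n)) (π * i / (2 * n))
  have fj := functional (π * i / (2 * n)) (π * j / (2 * n)) (π * j / (2 * n))
  have fk := functional (π * i / (2 * n)) (π * j / (2 * n)) (π * k / (2 * n))
  have fl := functional (π * i / (2 * n)) (π * j / (2 * n)) (π * l / (2 * n))
  rw [← hia, sub_self, Real.sin_zero] at fi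
  rw [← hja, sub_self (π * j / (2 * n)), Real.sin_zero] at fj
  rw [← hkb] at fk
  rw [← hlb] at fl
  obtain ⟨ski, ski'⟩ := sin_half_sign n hn k i hk hi
  obtain ⟨skj, skj'⟩ := sin_half_sign n hn k j hk hj
  obtain ⟨sli, sli'⟩ := sin_half_sign n hn l i hl hi
  obtain ⟨slj, slj'⟩ := sin_half_sign n hn l j hl hj
  generalize Real.sin (π * k / (2 * n) - π * i / (2 * n)) = Ski at *
  generalize Real.sin (π * k / (2 * n) - π * j / (2 * n)) = Skj at *
  generalize Real.sin (π * l / (2 * n) - π * i / (2 * n)) = Sli at *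
  generalize Real.sin (π * l / (2 * n) - π * j / (2 * n)) = Slj at *
  have hsign : (0 < Ski * Skj ∧ 0 < Sli * Slj) ∨ (Ski * Skj < 0 ∧ Sli * Slj < 0) := by
    have P : ∀ (t : ℕ) (x y : ℝ), t ≠ i → t ≠ j → (t < i → x < 0) → (i < t → 0 < x) →
        (t < j → y < 0) → (j < t → 0 < y) →
        ((t < i ↔ t < j) → 0 < x * y) ∧ (¬ (t < i ↔ t < j) → x * y < 0) := by
      intro t x y h1 h2 h3 h4 h5 h6
      rcases lt_or_gt_of_ne h1 with h | h <;> rcases lt_or_gt_of_ne h2 with h' | h'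
      · exact ⟨fun _ => mul_pos_of_neg_of_neg (h3 h) (h5 h'), fun q => by omega⟩
      · exact ⟨fun q => by omega, fun _ => mul_neg_of_neg_of_pos (h3 h) (h6 h')⟩
      · exact ⟨fun q => by omega, fun _ => mul_neg_of_pos_of_neg (h4 h) (h5 h')⟩
      · exact ⟨fun _ => mul_pos (h4 h) (h6 h'), fun q => by omega⟩
    have Pk := P k Ski Skj hki hkj ski ski' skj skj'
    have Pl := P l Sli Slj hli hlj sli sli' slj slj'
    by_cases q : (k < i ↔ k < j)
    · exact Or.inl ⟨Pk.1 q, Pl.1 (hc.1 q)⟩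
    · exact Or.inr ⟨Pk.2 q, Pl.2 (fun r => q (hc.2 r))⟩
  rw [Set.disjoint_left]
  rintro z ⟨α, β, hα, hβ, hαβ, rfl⟩ ⟨γ, δ, hγ, hδ, hγδ, hz⟩
  have zr := congrArg Complex.re hz
  have zi := congrArg Complex.im hz
  simp only [Complex.add_re, Complex.add_im, Complex.real_smul, Complex.re_ofReal_mul,
    Complex.im_ofReal_mul] at zr zi
  generalize Real.cos (π * i / (2 * n) + π * j / (2 * n)) = C at *
  generalize Real.sin (π * i / (2 * n) + π * j / (2 * n)) = S at *
  generalize Real.cos (π * i / (2 * n) - π * j / (2 * n)) = d at *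
  have e : γ * (Ski * Skj) + δ * (Sli * Slj) = 0 := by
    linear_combination (-1/2) * (C * zr + S * zi) + (1/2) * (γ * fk + δ * fl)
      - (1/2) * (α * fi + β * fj) + (1/2) * d * (hγδ - hαβ)
  have hδ' : δ = 1 - γ := by linarith
  rcases hsign with ⟨h1, h2⟩ | ⟨h1, h2⟩
  · rcases hγ.eq_or_lt with h | h
    · subst h; nlinarith
    · have := mul_pos h h1
      have := mul_nonneg hδ h2.le
      linarith
  · rcases hγ.eq_or_lt with h | h
    · subst h; nlinarith
    · have := mul_neg_of_pos_of_neg h h1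
      have := mul_nonpos_of_nonneg_of_nonpos hδ h2.le
      linarith
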